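/- (Pfaff-type recurrence for the q-Chu–Vandermonde sum) Let q be a nonzero complex number, let n ≥ 1 be an integer, and let a, c be complex numbers with (q;q)_n ≠ 0 and (c;q)_n ≠ 0. Define S_n(a,c;q) := ∑_{j=0}^{n} ((a;q)_j (q^{-n};q)_j / ((q;q)_j (c;q)_j)) q^j. Then S_n(a,c;q) − S_{n−1}(a,c;q) = − (q^{-n+1}(1−a)/(1−c)) · S_{n−1}(aq, cq; q), where S_{n−1}(aq,cq;q) = ∑_{j=0}^{n−1} ((aq;q)_j (q^{-n+1};q)_j / ((q;q)_j (cq;q)_j)) q^j. -/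

import Mathlib

/-- The $q$-shifted factorial $(a;q)_m = \prod_{k=0}^{m-1}(1 - a q^k)$. -/
noncomputable def qPoch (q a : ℂ) (m : ℕ) : ℂ := ∏ k ∈ Finset.range m, (1 - a * q ^ k)

/-- The terminating $q$-Chu–Vandermonde sum
$S_n(a,c;q) = \sum_{j=0}^n \frac{(a;q)_j (q^{-n};q)_j}{(q;q)_j (c;q)_j} q^j$. -/
noncomputable def Scv (q a c : ℂ) (n : ℕ) : ℂ :=
  ∑ j ∈ Finset.range (n + 1),
    qPoch q a j * qPoch q (q ^ (-(n : ℤ))) j / (qPoch q q j * qPoch q c j) * q ^ j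

theorem qPoch_zero (q a : ℂ) : qPoch q a 0 = 1 :=
  Finset.prod_range_zero _

theorem qPoch_succ (q a : ℂ) (m : ℕ) :
    qPoch q a (m + 1) = qPoch q a m * (1 - a * q ^ m) :=
  Finset.prod_range_succ _ _

theorem qPoch_succ' (q a : ℂ) (m : ℕ) :
    qPoch q a (m + 1) = (1 - a) * qPoch q (a * q) m := by
  simp only [qPoch, Finset.prod_range_succ', pow_zero, mul_one]
  rw [mul_comm]
  simp only [pow_succ', mul_assoc]

theorem qPoch_ne_zero_of_le {q a : ℂ} {m n : ℕ} (hmn : m ≤ n) (h : qPoch q a n ≠ 0) :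
    qPoch q a m ≠ 0 := by
  rw [qPoch, Finset.prod_ne_zero_iff] at h ⊢
  exact fun k hk => h k (Finset.range_mono hmn hk)

theorem qPoch_zpow_neg_succ {q : ℂ} (hq : q ≠ 0) (m : ℕ) :
    qPoch q (q ^ (-(m : ℤ))) (m + 1) = 0 := by
  rw [qPoch_succ, zpow_neg, zpow_natCast, inv_mul_cancel₀ (pow_ne_zero m hq), sub_self, mul_zero]

/-- Lowering `x * q` to `x` in a `q`-shifted factorial. -/
theorem qPoch_sub_qPoch_mul (q x : ℂ) (j : ℕ) :
    qPoch q x (j + 1) - qPoch q (x * q) (j + 1)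
      = -(x * (1 - q * q ^ j) * qPoch q (x * q) j) := by
  rw [qPoch_succ' q x, qPoch_succ q (x * q)]
  ring

/-- The sum `Scv q a c m` may be extended by its vanishing term of index `m + 1`. -/
theorem Scv_eq_sum_range_add_two {q : ℂ} (hq : q ≠ 0) (a c : ℂ) (m : ℕ) :
    Scv q a c m = ∑ j ∈ Finset.range (m + 1 + 1),
      qPoch q a j * qPoch q (q ^ (-(m : ℤ))) j / (qPoch q q j * qPoch q c j) * q ^ j := by
  rw [Finset.sum_range_succ _ (m + 1), qPoch_zpow_neg_succ hq, Scv]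
  simp

/-- Pfaff-type recurrence for the $q$-Chu–Vandermonde sum. -/
theorem cv_recurrence (q : ℂ) (hq : q ≠ 0) (n : ℕ) (hn : 1 ≤ n) (a c : ℂ)
    (hqq : qPoch q q n ≠ 0) (hc : qPoch q c n ≠ 0) :
    Scv q a c n - Scv q a c (n - 1)
      = -(q ^ (1 - (n : ℤ)) * (1 - a) / (1 - c)) * Scv q (a * q) (c * q) (n - 1) := by
  obtain ⟨m, rfl⟩ := Nat.exists_eq_add_of_le' hn
  have hx : q ^ (-((m + 1 : ℕ) : ℤ)) * q = q ^ (-(m : ℤ)) := by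
    rw [← zpow_add_one₀ hq]
    congr 1
    push_cast
    ring
  have hy : q ^ (1 - ((m + 1 : ℕ) : ℤ)) = q ^ (-((m + 1 : ℕ) : ℤ)) * q := by
    rw [hx]
    congr 1
    push_cast
    ring
  rw [Nat.add_sub_cancel, Scv_eq_sum_range_add_two hq a c m, hy, Scv, Scv, ← hx,
    ← Finset.sum_sub_distrib, Finset.sum_range_succ', Finset.mul_sum]
  generalize q ^ (-((m + 1 : ℕ) : ℤ)) = x
  simp only [qPoch_zero, sub_self, add_zero]
  refine Finset.sum_congr rfl fun j hj => ?_
  have hne : qPoch q q (j + 1) ≠ 0 :=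
    qPoch_ne_zero_of_le (Nat.succ_le_of_lt (Finset.mem_range.mp hj)) hqq
  rw [← sub_mul, ← sub_div, ← mul_sub, qPoch_sub_qPoch_mul]
  rw [qPoch_succ] at hne
  rw [qPoch_succ q q, qPoch_succ' q a, qPoch_succ' q c]
  obtain ⟨h₁, h₂⟩ := mul_ne_zero_iff.mp hne
  field_simp
  ring
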